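/- arXiv:1111.0643 — 2 statements merged into one kernel-verified Lean document; each statement's English description precedes it below -/
import Mathlib

section
/- Let L > 0, \gamma > 0 be real numbers and let s be a complex number with 1/2 < Re(s) < 1. Then \sum_{j=1}^{\infty} ((j\pi/L)^2 + \gamma)^{-s} = (\sin(\pi s)/\pi) \cdot \int_{\sqrt{\gamma}}^{\infty} (t^2 - \gamma)^{-s} (L \coth(tL) - 1/t) \, dt, where both the series and the improper integral converge. -/
open MeasureTheory

/-- The partial fraction expansion of the hyperbolic cotangent, rescaled by `L`. -/
theorem hasSum_coth_sub_inv {L t : ℝ} (hL : 0 < L) (ht : 0 < t) :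
    HasSum (fun j : ℕ => 2 * t / (t ^ 2 + ((j + 1 : ℝ) * Real.pi / L) ^ 2))
      (L * (Real.cosh (t * L) / Real.sinh (t * L)) - 1 / t) := by
  have hπ := Real.pi_pos
  have hI : ∀ y : ℝ, 0 < y → (Complex.I * y : ℂ) ∈ Complex.integerComplement := by
    rintro y hy ⟨n, hn⟩
    have := congrArg Complex.im hn
    simp at this
    exact hy.ne this
  have hx := hI (t * L / Real.pi) (by positivity)
  have h := (summable_cotTerm hx).hasSum
  rw [← cot_series_rep' hx] at h
  have h2 := h.mul_left (Complex.I * L / Real.pi)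
  rw [← Complex.hasSum_ofReal]
  have hLc : (L : ℂ) ≠ 0 := by exact_mod_cast hL.ne'
  have htc : (t : ℂ) ≠ 0 := by exact_mod_cast ht.ne'
  have hπc : (Real.pi : ℂ) ≠ 0 := by exact_mod_cast hπ.ne'
  rw [show ((L * (Real.cosh (t * L) / Real.sinh (t * L)) - 1 / t : ℝ) : ℂ) = _ from ?_]
  · refine h2.congr_fun fun j => ?_
    have hd : (((t ^ 2 + ((j + 1 : ℝ) * Real.pi / L) ^ 2 : ℝ)) : ℂ) ≠ 0 := by
      exact_mod_cast (by positivity : t ^ 2 + ((j + 1 : ℝ) * Real.pi / L) ^ 2 ≠ 0)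
    rw [cotTerm_identity hx, Complex.ofReal_div, div_eq_iff hd]
    push_cast
    have hD : (t ^ 2 + ((j + 1) * Real.pi / L) ^ 2 : ℂ) ≠ 0 := by
      exact_mod_cast hd
    have hfac : (Complex.I * (t * L / Real.pi) + (j + 1) : ℂ) *
          (Complex.I * (t * L / Real.pi) - (j + 1))
        = - (L / Real.pi) ^ 2 * (t ^ 2 + ((j + 1) * Real.pi / L) ^ 2) := by
      field_simp
      linear_combination (t : ℂ) ^ 2 * L ^ 2 * Complex.I_sq
    rw [one_div, hfac]
    generalize (t ^ 2 + ((j + 1) * Real.pi / L) ^ 2 : ℂ) = D at hD ⊢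
    field_simp
    linear_combination Complex.I_sq
  · have hsinh : Complex.sinh (t * L) ≠ 0 := by
      have : Real.sinh (t * L) ≠ 0 := (Real.sinh_pos_iff.2 (by positivity)).ne'
      exact_mod_cast this
    have e : (Real.pi : ℂ) * (Complex.I * ((t * L / Real.pi : ℝ) : ℂ)) = (t * L) * Complex.I := by
      push_cast
      field_simp
    rw [e, Complex.cot, Complex.cos_mul_I, Complex.sin_mul_I]
    push_cast
    field_simp

/-- The substitution `t ↦ (t ^ 2 - γ) / (t ^ 2 + E)` turns `sqrt γ < t` into `(0, 1)`. -/
theorem image_div_Ioi_sqrt {γ E : ℝ} (hγ : 0 < γ) (hE : 0 ≤ E) :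
    (fun t : ℝ => (t ^ 2 - γ) / (t ^ 2 + E)) '' Set.Ioi (Real.sqrt γ) = Set.Ioo 0 1 := by
  ext x
  constructor
  · rintro ⟨t, ht, rfl⟩
    have ht2 : γ < t ^ 2 := (Real.sqrt_lt' ((Real.sqrt_nonneg γ).trans_lt ht)).1 ht
    have hd : 0 < t ^ 2 + E := by linarith
    exact ⟨div_pos (by linarith) hd, (div_lt_one hd).2 (by linarith)⟩
  · rintro ⟨h0, h1⟩
    have h1' : 0 < 1 - x := by linarith
    refine ⟨Real.sqrt ((γ + E * x) / (1 - x)), ?_, ?_⟩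
    · refine Real.sqrt_lt_sqrt hγ.le ((lt_div_iff₀ h1').2 ?_)
      nlinarith [mul_pos hγ h0, mul_nonneg hE h0.le]
    · have hn : 0 ≤ (γ + E * x) / (1 - x) := by positivity
      simp only [Real.sq_sqrt hn]
      have : (γ + E * x) / (1 - x) + E = (γ + E) / (1 - x) := by field_simp; ring
      rw [this]
      have : γ + E ≠ 0 := by positivity
      field_simp
      ring

theorem injOn_div_Ioi_sqrt {γ E : ℝ} (hγ : 0 < γ) (hE : 0 ≤ E) :
    Set.InjOn (fun t : ℝ => (t ^ 2 - γ) / (t ^ 2 + E)) (Set.Ioi (Real.sqrt γ)) := by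
  intro a ha b hb hab
  have ha0 : 0 < a := (Real.sqrt_nonneg γ).trans_lt ha
  have hb0 : 0 < b := (Real.sqrt_nonneg γ).trans_lt hb
  have h1 : a ^ 2 + E ≠ 0 := by positivity
  have h2 : b ^ 2 + E ≠ 0 := by positivity
  simp only [div_eq_div_iff h1 h2] at hab
  have h3 : (γ + E) * (a ^ 2 - b ^ 2) = 0 := by linear_combination hab
  have h4 : a ^ 2 = b ^ 2 := by
    rcases mul_eq_zero.1 h3 with h | h
    · linarith
    · linarith
  exact (pow_left_inj₀ ha0.le hb0.le two_ne_zero).1 h4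

theorem hasDerivAt_div_sq {γ E t : ℝ} (h : t ^ 2 + E ≠ 0) :
    HasDerivAt (fun t : ℝ => (t ^ 2 - γ) / (t ^ 2 + E))
      (2 * t * (γ + E) / (t ^ 2 + E) ^ 2) t := by
  have h1 := (((hasDerivAt_id t).pow 2).sub_const γ).div (((hasDerivAt_id t).pow 2).add_const E) h
  refine h1.congr_deriv ?_
  simp
  ring

/-- The Beta integrand pulled back along `t ↦ (t ^ 2 - γ) / (t ^ 2 + E)`. -/
theorem abs_deriv_smul_beta_integrand {γ E t : ℝ} (hγ : 0 < γ) (hE : 0 ≤ E)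
    (ht : Real.sqrt γ < t) (s : ℂ) :
    |2 * t * (γ + E) / (t ^ 2 + E) ^ 2| •
      ((((t ^ 2 - γ) / (t ^ 2 + E) : ℝ) : ℂ) ^ ((1 - s) - 1) *
        (1 - (((t ^ 2 - γ) / (t ^ 2 + E) : ℝ) : ℂ)) ^ (s - 1)) =
      ((γ + E : ℝ) : ℂ) ^ s *
        (((t ^ 2 - γ : ℝ) : ℂ) ^ (-s) * ((2 * t / (t ^ 2 + E) : ℝ) : ℂ)) := by
  have ht0 : 0 < t := (Real.sqrt_nonneg γ).trans_lt ht
  have ht2 : 0 < t ^ 2 - γ := sub_pos.2 ((Real.sqrt_lt' ht0).1 ht)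
  have hd : 0 < t ^ 2 + E := by positivity
  have hb : 0 < γ + E := by positivity
  have h1 : (1 - (((t ^ 2 - γ) / (t ^ 2 + E) : ℝ) : ℂ)) = (((γ + E) / (t ^ 2 + E) : ℝ) : ℂ) := by
    rw [← Complex.ofReal_one, ← Complex.ofReal_sub]
    congr 1
    field_simp
    ring
  rw [h1, abs_of_pos (by positivity), Complex.real_smul]
  have key : ∀ x : ℝ, 0 < x → ∀ z : ℂ, ((x / (t ^ 2 + E) : ℝ) : ℂ) ^ z =
      (x : ℂ) ^ z * ((t ^ 2 + E : ℝ) : ℂ) ^ (-z) := by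
    intro x hx z
    rw [div_eq_mul_inv, Complex.ofReal_mul, Complex.mul_cpow_ofReal_nonneg hx.le (by positivity),
      Complex.ofReal_inv, Complex.inv_cpow, Complex.cpow_neg]
    rw [Complex.arg_ofReal_of_nonneg hd.le]
    exact Real.pi_pos.ne
  have hdc : ((t ^ 2 + E : ℝ) : ℂ) ≠ 0 := by exact_mod_cast hd.ne'
  have hbc : ((γ + E : ℝ) : ℂ) ≠ 0 := by exact_mod_cast hb.ne'
  rw [key _ ht2, key _ hb, show (1 - s) - 1 = -s by ring, neg_neg,
    show -(s - 1) = 1 - s by ring, Complex.cpow_sub _ _ hbc, Complex.cpow_sub _ _ hdc,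
    Complex.cpow_one, Complex.cpow_one]
  have hds : ((t ^ 2 + E : ℝ) : ℂ) ^ s ≠ 0 := fun h => hdc ((Complex.cpow_eq_zero_iff _ _).1 h).1
  generalize ((t ^ 2 - γ : ℝ) : ℂ) ^ (-s) = A
  rw [Complex.ofReal_div, Complex.ofReal_div, Complex.ofReal_mul, Complex.ofReal_pow _ 2]
  field_simp

section Integrals

variable {γ E : ℝ} {s : ℂ}

theorem integrableOn_beta_integrand (hs₀ : 0 < s.re) (hs₁ : s.re < 1) :
    IntegrableOn (fun x : ℝ => (x : ℂ) ^ ((1 - s) - 1) * (1 - (x : ℂ)) ^ (s - 1))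
      (Set.Ioo 0 1) := by
  have := Complex.betaIntegral_convergent (u := 1 - s) (v := s) (by simpa using hs₁) hs₀
  rwa [intervalIntegrable_iff_integrableOn_Ioo_of_le zero_le_one] at this

theorem integral_beta_integrand (hs₀ : 0 < s.re) (hs₁ : s.re < 1) :
    ∫ x in Set.Ioo (0 : ℝ) 1, (x : ℂ) ^ ((1 - s) - 1) * (1 - (x : ℂ)) ^ (s - 1) =
      Real.pi / Complex.sin (Real.pi * s) := by
  have h := Complex.Gamma_mul_Gamma_eq_betaIntegral (s := 1 - s) (t := s) (by simpa using hs₁) hs₀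
  rw [sub_add_cancel, Complex.Gamma_one, one_mul, mul_comm, Complex.Gamma_mul_Gamma_one_sub] at h
  rw [h, Complex.betaIntegral, intervalIntegral.integral_of_le zero_le_one,
    integral_Ioc_eq_integral_Ioo]

theorem integrableOn_cpow_mul_div (hγ : 0 < γ) (hE : 0 ≤ E) (hs₀ : 0 < s.re) (hs₁ : s.re < 1) :
    IntegrableOn (fun t : ℝ => ((t ^ 2 - γ : ℝ) : ℂ) ^ (-s) * ((2 * t / (t ^ 2 + E) : ℝ) : ℂ))
      (Set.Ioi (Real.sqrt γ)) := by
  have h := integrableOn_beta_integrand hs₀ hs₁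
  rw [← image_div_Ioi_sqrt hγ hE, integrableOn_image_iff_integrableOn_abs_deriv_smul
    measurableSet_Ioi (fun t ht => (hasDerivAt_div_sq ?_).hasDerivWithinAt)
    (injOn_div_Ioi_sqrt hγ hE)] at h
  · replace h := h.congr_fun (fun t ht => abs_deriv_smul_beta_integrand hγ hE ht s)
      measurableSet_Ioi
    have hb : ((γ + E : ℝ) : ℂ) ^ s ≠ 0 := by
      have : ((γ + E : ℝ) : ℂ) ≠ 0 := by exact_mod_cast (by positivity : γ + E ≠ 0)
      exact fun h => this ((Complex.cpow_eq_zero_iff _ _).1 h).1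
    exact (integrable_const_mul_iff (IsUnit.mk0 _ hb) _).1 h
  · have : 0 < t := (Real.sqrt_nonneg γ).trans_lt ht
    positivity

theorem integral_cpow_mul_div (hγ : 0 < γ) (hE : 0 ≤ E) (hs₀ : 0 < s.re) (hs₁ : s.re < 1) :
    ∫ t in Set.Ioi (Real.sqrt γ), ((t ^ 2 - γ : ℝ) : ℂ) ^ (-s) * ((2 * t / (t ^ 2 + E) : ℝ) : ℂ) =
      ((γ + E : ℝ) : ℂ) ^ (-s) * (Real.pi / Complex.sin (Real.pi * s)) := by
  have hbc : ((γ + E : ℝ) : ℂ) ≠ 0 := by exact_mod_cast (by positivity : γ + E ≠ 0)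
  have hb : ((γ + E : ℝ) : ℂ) ^ s ≠ 0 := fun h => hbc ((Complex.cpow_eq_zero_iff _ _).1 h).1
  rw [← integral_beta_integrand hs₀ hs₁, ← image_div_Ioi_sqrt hγ hE,
    integral_image_eq_integral_abs_deriv_smul
    measurableSet_Ioi (fun t ht => (hasDerivAt_div_sq ?_).hasDerivWithinAt)
    (injOn_div_Ioi_sqrt hγ hE),
    setIntegral_congr_fun measurableSet_Ioi
      (fun t ht => abs_deriv_smul_beta_integrand hγ hE ht s),
    integral_const_mul, Complex.cpow_neg, inv_mul_cancel_left₀ hb]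
  have : 0 < t := (Real.sqrt_nonneg γ).trans_lt ht
  positivity

theorem integral_norm_cpow_mul_div (hγ : 0 < γ) (hE : 0 ≤ E) (s : ℂ) :
    ∫ t in Set.Ioi (Real.sqrt γ),
        ‖((t ^ 2 - γ : ℝ) : ℂ) ^ (-s) * ((2 * t / (t ^ 2 + E) : ℝ) : ℂ)‖ =
      (γ + E) ^ (-s.re) *
        ∫ x in Set.Ioo (0 : ℝ) 1, ‖(x : ℂ) ^ ((1 - s) - 1) * (1 - (x : ℂ)) ^ (s - 1)‖ := by
  have hpos : 0 < γ + E := by positivity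
  have hb : (γ + E) ^ s.re ≠ 0 := (Real.rpow_pos_of_pos hpos _).ne'
  have hcongr : ∀ t ∈ Set.Ioi (Real.sqrt γ), |2 * t * (γ + E) / (t ^ 2 + E) ^ 2| •
      ‖(((t ^ 2 - γ) / (t ^ 2 + E) : ℝ) : ℂ) ^ ((1 - s) - 1) *
        (1 - (((t ^ 2 - γ) / (t ^ 2 + E) : ℝ) : ℂ)) ^ (s - 1)‖ =
      (γ + E) ^ s.re *
        ‖((t ^ 2 - γ : ℝ) : ℂ) ^ (-s) * ((2 * t / (t ^ 2 + E) : ℝ) : ℂ)‖ := by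
    intro t ht
    have h := congrArg norm (abs_deriv_smul_beta_integrand hγ hE ht s)
    rwa [norm_smul, norm_mul (((γ + E : ℝ) : ℂ) ^ s), Complex.norm_cpow_eq_rpow_re_of_pos hpos,
      Real.norm_eq_abs, abs_abs] at h
  rw [← image_div_Ioi_sqrt hγ hE,
    integral_image_eq_integral_abs_deriv_smul
    measurableSet_Ioi (fun t ht => (hasDerivAt_div_sq ?_).hasDerivWithinAt)
    (injOn_div_Ioi_sqrt hγ hE),
    setIntegral_congr_fun measurableSet_Ioi hcongr,
    integral_const_mul, Real.rpow_neg hpos.le, inv_mul_cancel_left₀ hb]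
  have : 0 < t := (Real.sqrt_nonneg γ).trans_lt ht
  positivity

end Integrals

/-- A pointwise convergent series of integrable functions whose `L¹` norms are summable has an
integrable sum. -/
theorem integrable_of_hasSum_of_summable_integral_norm {α : Type*} [MeasurableSpace α]
    {μ : Measure α} {F : ℕ → α → ℂ} {f : α → ℂ} (hF : ∀ i, Integrable (F i) μ)
    (hsum : Summable fun i => ∫ a, ‖F i a‖ ∂μ) (hf : ∀ᵐ a ∂μ, HasSum (fun i => F i a) (f a)) :
    Integrable f μ := by
  refine ⟨aestronglyMeasurable_of_tendsto_ae Filter.atTop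
    (f := fun n a => ∑ i ∈ Finset.range n, F i a)
    (fun n => ?_) (hf.mono fun a ha => ha.tendsto_sum_nat), ?_⟩
  · exact (integrable_finsetSum _ fun i _ => hF i).1
  · have hbound : ∫⁻ a, ‖f a‖ₑ ∂μ ≤ ∑' i, ∫⁻ a, ‖F i a‖ₑ ∂μ := by
      rw [← lintegral_tsum fun i => (hF i).1.enorm]
      refine lintegral_mono_ae (hf.mono fun a ha => ?_)
      rw [← ha.tsum_eq]
      exact enorm_tsum_le_tsum_enorm
    refine hbound.trans_lt ?_
    simp_rw [← ofReal_integral_norm_eq_lintegral_enorm (hF _)]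
    rw [← ENNReal.ofReal_tsum_of_nonneg (fun i => integral_nonneg fun a => norm_nonneg _) hsum]
    exact ENNReal.ofReal_lt_top

theorem summable_add_sq_rpow {L γ σ : ℝ} (hL : 0 < L) (hγ : 0 < γ) (hσ : 1 / 2 < σ) :
    Summable fun j : ℕ => (γ + ((j + 1 : ℝ) * Real.pi / L) ^ 2) ^ (-σ) := by
  have hπ := Real.pi_pos
  have h : Summable fun j : ℕ => ((j + 1 : ℕ) : ℝ) ^ (-(2 * σ)) :=
    (summable_nat_add_iff 1).2 (Real.summable_nat_rpow.2 (by linarith))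
  refine Summable.of_nonneg_of_le (fun j => by positivity) (fun j => ?_)
    (h.mul_left ((Real.pi / L) ^ (-(2 * σ))))
  have hx : 0 < (j + 1 : ℝ) * Real.pi / L := by positivity
  calc (γ + ((j + 1 : ℝ) * Real.pi / L) ^ 2) ^ (-σ)
      ≤ (((j + 1 : ℝ) * Real.pi / L) ^ 2) ^ (-σ) :=
        Real.rpow_le_rpow_of_nonpos (by positivity) (by linarith) (by linarith)
    _ = ((Real.pi / L) * ((j + 1 : ℕ) : ℝ)) ^ (-(2 * σ)) := by
        rw [← Real.rpow_natCast, ← Real.rpow_mul hx.le]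
        push_cast
        congr 1 <;> ring
    _ = _ := Real.mul_rpow (by positivity) (by positivity)

/-- For `L, γ > 0` and `1/2 < Re s < 1`, the Dirichlet spectral zeta series with
spectral parameter `γ` equals the contour-rotated integral
`(sin(πs)/π) ∫_{√γ}^∞ (t² - γ)^{-s} (L coth(tL) - 1/t) dt`,
where `coth(tL) = cosh(tL)/sinh(tL)`; both the series and the improper
integral converge. -/
theorem stmt_4 (L γ : ℝ) (hL : 0 < L) (hγ : 0 < γ) (s : ℂ)
    (hs₁ : 1 / 2 < s.re) (hs₂ : s.re < 1) :
    IntegrableOn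
      (fun t : ℝ => ((t ^ 2 - γ : ℝ) : ℂ) ^ (-s) *
        ((L * (Real.cosh (t * L) / Real.sinh (t * L)) - 1 / t : ℝ) : ℂ))
      (Set.Ioi (Real.sqrt γ)) ∧
    HasSum (fun j : ℕ => ((((j + 1 : ℝ) * Real.pi / L) ^ 2 + γ : ℝ) : ℂ) ^ (-s))
      (Complex.sin (Real.pi * s) / Real.pi *
        ∫ t in Set.Ioi (Real.sqrt γ),
          ((t ^ 2 - γ : ℝ) : ℂ) ^ (-s) *
            ((L * (Real.cosh (t * L) / Real.sinh (t * L)) - 1 / t : ℝ) : ℂ)) := by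
  have hπ := Real.pi_pos
  have hs₀ : 0 < s.re := by linarith
  set E : ℕ → ℝ := fun j => ((j + 1 : ℝ) * Real.pi / L) ^ 2
  have hE : ∀ j, 0 ≤ E j := fun j => sq_nonneg _
  have hF := fun j => integrableOn_cpow_mul_div hγ (hE j) hs₀ hs₂
  have hsum : Summable fun j => ∫ t in Set.Ioi (Real.sqrt γ),
      ‖((t ^ 2 - γ : ℝ) : ℂ) ^ (-s) * ((2 * t / (t ^ 2 + E j) : ℝ) : ℂ)‖ := by
    simp_rw [fun j => integral_norm_cpow_mul_div hγ (hE j) s]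
    exact (summable_add_sq_rpow hL hγ hs₁).mul_right _
  have hpt : ∀ t ∈ Set.Ioi (Real.sqrt γ), HasSum
      (fun j => ((t ^ 2 - γ : ℝ) : ℂ) ^ (-s) * ((2 * t / (t ^ 2 + E j) : ℝ) : ℂ))
      (((t ^ 2 - γ : ℝ) : ℂ) ^ (-s) *
        ((L * (Real.cosh (t * L) / Real.sinh (t * L)) - 1 / t : ℝ) : ℂ)) := fun t ht =>
    (Complex.hasSum_ofReal.2
      (hasSum_coth_sub_inv hL ((Real.sqrt_nonneg γ).trans_lt ht))).mul_left _
  refine ⟨integrable_of_hasSum_of_summable_integral_norm hF hsum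
    (ae_restrict_of_forall_mem measurableSet_Ioi hpt), ?_⟩
  have hsin : Complex.sin (Real.pi * s) ≠ 0 := by
    have h := Complex.Gamma_mul_Gamma_one_sub s
    intro h0
    rw [h0, div_zero, mul_eq_zero] at h
    rcases h with h | h
    · exact Complex.Gamma_ne_zero_of_re_pos hs₀ h
    · exact Complex.Gamma_ne_zero_of_re_pos (by simpa using hs₂) h
  have h := (hasSum_integral_of_summable_integral_norm hF hsum).mul_left
    (Complex.sin (Real.pi * s) / Real.pi)
  rw [setIntegral_congr_fun measurableSet_Ioi (fun t ht => (hpt t ht).tsum_eq)] at h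
  refine h.congr_fun fun j => ?_
  have hπc : (Real.pi : ℂ) ≠ 0 := by exact_mod_cast hπ.ne'
  change ((E j + γ : ℝ) : ℂ) ^ (-s) = _
  rw [integral_cpow_mul_div hγ (hE j) hs₀ hs₂, add_comm γ]
  generalize ((E j + γ : ℝ) : ℂ) ^ (-s) = A
  field_simp
end

section
/- Let L > 0 and let V : \mathbb{R} \to \mathbb{R} be infinitely differentiable. Then there exists T > 0 such that for every t \geq T the boundary value problem f''(x) = (V(x) + t^2)\,f(x) on [0,L] with f(0) = 1, f(L) = 0 has a unique twice continuously differentiable solution f_t, and t\,(f_t'(0) + t) \to -V(0)/2 as t \to \infty. -/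
open Filter Topology

theorem hasDerivAt_deriv {f : ℝ → ℝ} (hf : ContDiff ℝ 2 f) (x : ℝ) :
    HasDerivAt f (deriv f x) x :=
  (hf.differentiable (by norm_num) x).hasDerivAt

theorem hasDerivAt_deriv_deriv {f : ℝ → ℝ} (hf : ContDiff ℝ 2 f) (x : ℝ) :
    HasDerivAt (deriv f) (deriv (deriv f) x) x := by
  have h : ContDiff ℝ 1 (deriv f) := (hf.deriv' (n := 1))
  exact (h.differentiable (by norm_num) x).hasDerivAt

/-- One-dimensional weak maximum principle: a function with `q z ≤ z''`, `q > 0`, that is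
nonpositive at both endpoints is nonpositive in between. -/
theorem nonpos_of_mul_le_second_deriv {L : ℝ} {z z' z'' q : ℝ → ℝ}
    (hz : ∀ x, HasDerivAt z (z' x) x) (hz' : ∀ x, HasDerivAt z' (z'' x) x)
    (hq : ∀ x ∈ Set.Icc 0 L, 0 < q x) (h : ∀ x ∈ Set.Icc 0 L, q x * z x ≤ z'' x)
    (h0 : z 0 ≤ 0) (hL : z L ≤ 0) : ∀ x ∈ Set.Icc 0 L, z x ≤ 0 := by
  intro x hx
  by_contra! hpos
  have hcont : Continuous z := continuous_iff_continuousAt.2 fun y => (hz y).continuousAt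
  obtain ⟨m, hm, hmax⟩ := isCompact_Icc.exists_isMaxOn ⟨x, hx⟩ hcont.continuousOn
  have hmpos : 0 < z m := hpos.trans_le (hmax hx)
  have hm0 : m ≠ 0 := by rintro rfl; linarith
  have hmL : m ≠ L := by rintro rfl; linarith
  have hloc : IsLocalMax z m :=
    hmax.isLocalMax (Icc_mem_nhds (lt_of_le_of_ne hm.1 hm0.symm) (lt_of_le_of_ne hm.2 hmL))
  have hd : deriv z = z' := funext fun y => (hz y).deriv
  have hdd : deriv (deriv z) m = z'' m := by rw [hd]; exact (hz' m).deriv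
  have hz''pos : 0 < z'' m := (mul_pos (hq m hm) hmpos).trans_le (h m hm)
  have hmin : IsLocalMin z m :=
    isLocalMin_of_deriv_deriv_pos (by rwa [hdd]) hloc.deriv_eq_zero hcont.continuousAt
  have hconst : z =ᶠ[𝓝 m] fun _ => z m := by
    filter_upwards [hloc, hmin] with y h1 h2 using le_antisymm h1 h2
  have hzero : deriv (deriv z) m = 0 := by
    rw [hconst.deriv.deriv_eq]
    simp
  linarith

/-- A function that is nonpositive on `[0, L]` and vanishes at `0` has nonpositive derivative
there. -/
theorem deriv_nonpos_of_nonpos {L : ℝ} (hL : 0 < L) {z : ℝ → ℝ} {d : ℝ}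
    (hz : HasDerivAt z d 0) (h0 : z 0 = 0) (h : ∀ x ∈ Set.Icc 0 L, z x ≤ 0) : d ≤ 0 := by
  refine le_of_tendsto hz.tendsto_slope_zero_right ?_
  filter_upwards [Ioo_mem_nhdsGT hL] with x hx
  have := h x ⟨hx.1.le, hx.2.le⟩
  simp only [zero_add, h0, sub_zero, smul_eq_mul]
  exact mul_nonpos_of_nonneg_of_nonpos (inv_nonneg.2 hx.1.le) this

/-- The Dirichlet problem `w'' = t² w + h`, `w(0) = 1`, `w(L) = 0` is solvable, by variation of
constants. -/
theorem exists_dirichlet_solution_const {L t : ℝ} (hL : 0 < L) (ht : 0 < t) {h : ℝ → ℝ}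
    (hh : Continuous h) :
    ∃ w w' : ℝ → ℝ, (∀ x, HasDerivAt w (w' x) x) ∧
      (∀ x, HasDerivAt w' (t ^ 2 * w x + h x) x) ∧ w 0 = 1 ∧ w L = 0 := by
  have hsinh (x : ℝ) :
      HasDerivAt (fun y => Real.sinh (t * y)) (t * Real.cosh (t * x)) x := by
    simpa [mul_comm] using ((hasDerivAt_id x).const_mul t).sinh
  have hcosh (x : ℝ) :
      HasDerivAt (fun y => Real.cosh (t * y)) (t * Real.sinh (t * x)) x := by
    simpa [mul_comm] using ((hasDerivAt_id x).const_mul t).cosh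
  obtain ⟨A, hA⟩ : ∃ A : ℝ → ℝ, (∀ x, HasDerivAt A (Real.cosh (t * x) * h x) x) :=
    ⟨fun x => ∫ y in (0 : ℝ)..x, Real.cosh (t * y) * h y, fun x =>
      (show Continuous fun y => Real.cosh (t * y) * h y by fun_prop).integral_hasStrictDerivAt
        0 x |>.hasDerivAt⟩
  obtain ⟨B, hB, hB0⟩ : ∃ B : ℝ → ℝ,
      (∀ x, HasDerivAt B (Real.sinh (t * x) * h x) x) ∧ B 0 = 0 :=
    ⟨fun x => ∫ y in (0 : ℝ)..x, Real.sinh (t * y) * h y, fun x =>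
      (show Continuous fun y => Real.sinh (t * y) * h y by fun_prop).integral_hasStrictDerivAt
        0 x |>.hasDerivAt, by simp⟩
  have hs : Real.sinh (t * L) ≠ 0 := (Real.sinh_pos_iff.2 (mul_pos ht hL)).ne'
  obtain ⟨c, hc⟩ : ∃ c : ℝ, (Real.sinh (t * L) * A L - Real.cosh (t * L) * B L) / t
      + c * Real.sinh (t * L) + Real.cosh (t * L) = 0 :=
    ⟨-((Real.sinh (t * L) * A L - Real.cosh (t * L) * B L) / t + Real.cosh (t * L))
      / Real.sinh (t * L), by rw [div_mul_cancel₀ _ hs]; ring⟩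
  refine ⟨fun x => (Real.sinh (t * x) * A x - Real.cosh (t * x) * B x) / t
      + c * Real.sinh (t * x) + Real.cosh (t * x),
    fun x => Real.cosh (t * x) * A x - Real.sinh (t * x) * B x
      + c * (t * Real.cosh (t * x)) + t * Real.sinh (t * x), fun x => ?_, fun x => ?_, ?_, hc⟩
  · refine ((((((hsinh x).mul (hA x)).sub ((hcosh x).mul (hB x))).div_const t).add
      ((hsinh x).const_mul c)).add (hcosh x)).congr_deriv ?_
    field_simp
    ring
  · refine (((((hcosh x).mul (hA x)).sub ((hsinh x).mul (hB x))).add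
      (((hcosh x).const_mul t).const_mul c)).add ((hsinh x).const_mul t)).congr_deriv ?_
    have hsq := Real.cosh_sq (t * x)
    field_simp
    linear_combination h x * hsq
  · simp [hB0]

/-- The Dirichlet problem `f'' = (V + t²) f`, `f(0) = 1`, `f(L) = 0` is solvable as soon as
`2 |V| ≤ t²` on `[0, L]`. -/
theorem exists_dirichlet_solution {L t M : ℝ} (hL : 0 < L) (ht : 0 < t) {V : ℝ → ℝ}
    (hV : Continuous V) (hM : ∀ x ∈ Set.Icc 0 L, |V x| ≤ M) (hMt : 2 * M ≤ t ^ 2) :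
    ∃ f : ℝ → ℝ, ContDiff ℝ 2 f ∧
      (∀ x ∈ Set.Icc 0 L, deriv (deriv f) x = (V x + t ^ 2) * f x) ∧ f 0 = 1 ∧ f L = 0 := by
  let proj : ℝ → Set.Icc 0 L := Set.projIcc 0 L hL.le
  have hproj : Continuous proj := continuous_projIcc
  let src (u : C(Set.Icc 0 L, ℝ)) (x : ℝ) : ℝ := V (proj x) * u (proj x)
  have hsrc (u) : Continuous (src u) := by fun_prop
  choose w w' hw hw' hw0 hwL using
    fun u => exists_dirichlet_solution_const hL ht (hsrc u)
  have hwc (u) : Continuous (w u) :=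
    continuous_iff_continuousAt.2 fun x => (hw u x).continuousAt
  let Φ (u : C(Set.Icc 0 L, ℝ)) : C(Set.Icc 0 L, ℝ) :=
    ⟨fun x => w u x, (hwc u).comp continuous_subtype_val⟩
  have hle (u v : C(Set.Icc 0 L, ℝ)) (x : ℝ) (hx : x ∈ Set.Icc 0 L) :
      w u x - w v x ≤ 1 / 2 * dist u v := by
    have key := nonpos_of_mul_le_second_deriv (L := L) (q := fun _ => t ^ 2)
      (fun x => ((hw u x).sub (hw v x)).sub_const (1 / 2 * dist u v))
      (fun x => (hw' u x).sub (hw' v x)) (fun _ _ => by positivity) ?_ ?_ ?_ x hx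
    · simpa using key
    · intro y hy
      have hpy : (proj y : ℝ) = y := by simp [proj, Set.projIcc_of_mem hL.le hy]
      have hd : |u (proj y) - v (proj y)| ≤ dist u v := by
        simpa [Real.dist_eq] using ContinuousMap.dist_apply_le_dist (f := u) (g := v) (proj y)
      have hV' : |V y * (u (proj y) - v (proj y))| ≤ M * dist u v := by
        rw [abs_mul]
        exact mul_le_mul (hM y hy) hd (abs_nonneg _) ((abs_nonneg _).trans (hM y hy))
      have := neg_le_of_abs_le hV'
      have := mul_le_mul_of_nonneg_right hMt (dist_nonneg (x := u) (y := v))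
      simp only [src, hpy, Pi.sub_apply]
      linarith
    · simp [hw0]
    · simp [hwL]
  have hΦ : ContractingWith (1 / 2) Φ := by
    refine ⟨by rw [← NNReal.coe_lt_coe]; norm_num, LipschitzWith.of_dist_le_mul fun u v => ?_⟩
    rw [ContinuousMap.dist_le (by positivity)]
    intro x
    have h1 := hle u v x x.2
    have h2 := hle v u x x.2
    rw [dist_comm] at h2
    rw [Real.dist_eq, abs_le]
    simp only [Φ, ContinuousMap.coe_mk, NNReal.coe_div, NNReal.coe_one, NNReal.coe_ofNat]
    constructor <;> linarith
  obtain ⟨u, hu⟩ : ∃ u, Φ u = u := ⟨_, hΦ.fixedPoint_isFixedPt⟩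
  have hd : deriv (w u) = w' u := funext fun x => (hw u x).deriv
  have hdd : deriv (w' u) = fun x => t ^ 2 * w u x + src u x :=
    funext fun x => (hw' u x).deriv
  refine ⟨w u, ?_, fun x hx => ?_, hw0 u, hwL u⟩
  · rw [show (2 : WithTop ℕ∞) = 1 + 1 by norm_num, contDiff_succ_iff_deriv, hd,
      contDiff_one_iff_deriv, hdd]
    exact ⟨fun x => (hw u x).differentiableAt, by simp, fun x => (hw' u x).differentiableAt,
      ((hwc u).const_mul _).add (hsrc u)⟩
  · have hpx : (proj x : ℝ) = x := by simp [proj, Set.projIcc_of_mem hL.le hx]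
    have hux : u (proj x) = w u x := by
      conv_lhs => rw [← hu]
      simp [Φ, hpx]
    rw [hd, hdd]
    simp only [src, hpx, hux]
    ring

/-- Solutions of `f'' = q f` with `q > 0` on `[0, L]` are determined by their boundary values. -/
theorem eqOn_of_dirichlet {L : ℝ} {q f g : ℝ → ℝ} (hq : ∀ x ∈ Set.Icc 0 L, 0 < q x)
    (hf : ContDiff ℝ 2 f) (hg : ContDiff ℝ 2 g)
    (hf2 : ∀ x ∈ Set.Icc 0 L, deriv (deriv f) x = q x * f x)
    (hg2 : ∀ x ∈ Set.Icc 0 L, deriv (deriv g) x = q x * g x)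
    (h0 : f 0 = g 0) (hL : f L = g L) : Set.EqOn f g (Set.Icc 0 L) := by
  have hle {f g : ℝ → ℝ} (hf : ContDiff ℝ 2 f) (hg : ContDiff ℝ 2 g)
      (hf2 : ∀ x ∈ Set.Icc 0 L, deriv (deriv f) x = q x * f x)
      (hg2 : ∀ x ∈ Set.Icc 0 L, deriv (deriv g) x = q x * g x)
      (h0 : f 0 = g 0) (hL : f L = g L) (x) (hx : x ∈ Set.Icc 0 L) : f x ≤ g x := by
    refine sub_nonpos.1 (nonpos_of_mul_le_second_deriv
      (fun x => (hasDerivAt_deriv hf x).sub (hasDerivAt_deriv hg x))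
      (fun x => (hasDerivAt_deriv_deriv hf x).sub (hasDerivAt_deriv_deriv hg x))
      hq (fun y hy => ?_) ?_ ?_ x hx)
    · rw [hf2 y hy, hg2 y hy, Pi.sub_apply, mul_sub]
    · simp [h0]
    · simp [hL]
  exact fun x hx => le_antisymm (hle hf hg hf2 hg2 h0 hL x hx)
    (hle hg hf hg2 hf2 h0.symm hL.symm x hx)

theorem hasDerivAt_exp_neg_quadratic (p r x : ℝ) :
    HasDerivAt (fun y => Real.exp (-(p * y + r * y ^ 2)))
      (-(p + 2 * r * x) * Real.exp (-(p * x + r * x ^ 2))) x := by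
  have h : HasDerivAt (fun y => -(p * y + r * y ^ 2)) (-(p + 2 * r * x)) x := by
    refine (((hasDerivAt_id x).const_mul p).add
      (((hasDerivAt_id x).pow 2).const_mul r)).neg.congr_deriv ?_
    simp
    ring
  exact h.exp.congr_deriv (by ring)

theorem hasDerivAt_deriv_exp_neg_quadratic (p r x : ℝ) :
    HasDerivAt (fun y => -(p + 2 * r * y) * Real.exp (-(p * y + r * y ^ 2)))
      (((p + 2 * r * x) ^ 2 - 2 * r) * Real.exp (-(p * x + r * x ^ 2))) x := by
  have h : HasDerivAt (fun y => -(p + 2 * r * y)) (-(2 * r)) x := by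
    refine (((hasDerivAt_id x).const_mul (2 * r)).const_add p).neg.congr_deriv ?_
    simp
  exact (h.mul (hasDerivAt_exp_neg_quadratic p r x)).congr_deriv (by ring)

/-- The supersolution `exp (-(p x + r x²))` bounds the initial slope from above. -/
theorem deriv_zero_le_of_supersolution {L p r : ℝ} (hL : 0 < L) {q f : ℝ → ℝ}
    (hq : ∀ x ∈ Set.Icc 0 L, 0 < q x) (hf : ContDiff ℝ 2 f)
    (hf2 : ∀ x ∈ Set.Icc 0 L, deriv (deriv f) x = q x * f x) (h0 : f 0 = 1) (hfL : f L = 0)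
    (hp : ∀ x ∈ Set.Icc 0 L, (p + 2 * r * x) ^ 2 - 2 * r ≤ q x) : deriv f 0 ≤ -p := by
  have hz (x) := (hasDerivAt_deriv hf x).sub (hasDerivAt_exp_neg_quadratic p r x)
  have key := deriv_nonpos_of_nonpos hL (hz 0) (by simp [h0])
    (nonpos_of_mul_le_second_deriv hz
      (fun x => (hasDerivAt_deriv_deriv hf x).sub (hasDerivAt_deriv_exp_neg_quadratic p r x))
      hq (fun x hx => ?_) (by simp [h0]) ?_)
  · simp at key
    linarith
  · have := mul_le_mul_of_nonneg_right (hp x hx) (Real.exp_pos (-(p * x + r * x ^ 2))).le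
    rw [hf2 x hx, Pi.sub_apply, mul_sub]
    linarith
  · simp [hfL, Real.exp_nonneg]

/-- The subsolution `(exp (-(p x + r x²)) - E) / (1 - E)` bounds the initial slope from below. -/
theorem le_deriv_zero_of_subsolution {L p r E : ℝ} (hL : 0 < L) {q f : ℝ → ℝ}
    (hq : ∀ x ∈ Set.Icc 0 L, 0 < q x) (hf : ContDiff ℝ 2 f)
    (hf2 : ∀ x ∈ Set.Icc 0 L, deriv (deriv f) x = q x * f x) (h0 : f 0 = 1) (hfL : f L = 0)
    (hp : ∀ x ∈ Set.Icc 0 L, q x ≤ (p + 2 * r * x) ^ 2 - 2 * r)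
    (hE0 : 0 ≤ E) (hE1 : E < 1) (hE : Real.exp (-(p * L + r * L ^ 2)) ≤ E) :
    -p / (1 - E) ≤ deriv f 0 := by
  have hE' : 0 < 1 - E := sub_pos.2 hE1
  have hz (x) := ((hasDerivAt_exp_neg_quadratic p r x).sub_const E).sub
    ((hasDerivAt_deriv hf x).const_mul (1 - E))
  have key := deriv_nonpos_of_nonpos hL (hz 0) (by simp [h0])
    (nonpos_of_mul_le_second_deriv hz
      (fun x => (hasDerivAt_deriv_exp_neg_quadratic p r x).sub
        ((hasDerivAt_deriv_deriv hf x).const_mul (1 - E)))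
      hq (fun x hx => ?_) (by simp [h0]) ?_)
  · rw [div_le_iff₀ hE']
    simp at key
    linarith
  · have h1 := mul_le_mul_of_nonneg_right (hp x hx) (Real.exp_pos (-(p * x + r * x ^ 2))).le
    have h2 := mul_nonneg (hq x hx).le hE0
    rw [hf2 x hx]
    simp only [Pi.sub_apply]
    linarith
  · simpa [hfL] using hE

/-- Two-sided bound on the initial slope of the Dirichlet solution for a potential that is
Lipschitz at `0`. -/
theorem deriv_zero_bounds {L K t : ℝ} (hL : 0 < L) (hK : 1 ≤ K) (ht : 4 * K * (1 + L) ≤ t)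
    {V f : ℝ → ℝ} (hV : ∀ x ∈ Set.Icc 0 L, |V x| ≤ K)
    (hVK : ∀ x ∈ Set.Icc 0 L, |V x - V 0| ≤ K * x) (hf : ContDiff ℝ 2 f)
    (hf2 : ∀ x ∈ Set.Icc 0 L, deriv (deriv f) x = (V x + t ^ 2) * f x)
    (h0 : f 0 = 1) (hfL : f L = 0) :
    t * (deriv f 0 + t) ≤ -V 0 / 2 + K / t ∧
      (-V 0 / 2 - K / t - t ^ 2 * Real.exp (-(t * L / 2))) / (1 - Real.exp (-(t * L / 2)))
        ≤ t * (deriv f 0 + t) := by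
  have hKL : 0 < K * L := by positivity
  have ht4 : 4 ≤ t := by nlinarith
  have ht0 : 0 < t := by linarith
  obtain ⟨s, hs⟩ : ∃ s, s = 1 / t := ⟨_, rfl⟩
  have hst : s * t = 1 := by rw [hs]; field_simp
  have hs0 : 0 < s := by rw [hs]; positivity
  have hKs : K * s ≤ 1 / 4 := by nlinarith
  have hKLs : K * L * s ≤ 1 / 4 := by nlinarith
  have hs4 : s ≤ 1 / 4 := by nlinarith
  have hKs0 : 0 < K * s := by positivity
  have hKss : K * s ^ 2 ≤ K * s / 4 := by nlinarith
  have hV0 := abs_le.1 (hV 0 ⟨le_rfl, hL.le⟩)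
  have hV0s : V 0 * s ≤ K * s ∧ -(K * s) ≤ V 0 * s := by constructor <;> nlinarith
  have hq : ∀ x ∈ Set.Icc 0 L, 0 < V x + t ^ 2 := fun x hx => by
    have := (abs_le.1 (hV x hx)).1
    nlinarith
  have hKt : K / t = K * s := by rw [hs]; ring
  constructor
  · have key := deriv_zero_le_of_supersolution (p := t + V 0 * s / 2 - K * s ^ 2)
      (r := -(K * s / 2)) hL hq hf hf2 h0 hfL fun x hx => ?_
    · have := mul_le_mul_of_nonneg_left key ht0.le
      rw [hKt]
      have e : t * -(t + V 0 * s / 2 - K * s ^ 2) = -t ^ 2 - V 0 / 2 + K * s := by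
        linear_combination (-V 0 / 2 + K * s) * hst
      linarith
    · have h1 := (abs_le.1 (hVK x hx)).1
      have hKsx : K * s * x ≤ 1 / 4 := by nlinarith [hx.2]
      have h2 : K * x ≤ 2 * (K * s * x) * (t + V 0 * s / 2 - K * s ^ 2 - K * s * x / 2) := by
        have h3 : t / 2 ≤ t + V 0 * s / 2 - K * s ^ 2 - K * s * x / 2 := by linarith
        have h4 : 0 ≤ 2 * (K * s * x) := by have := hx.1; positivity
        calc K * x = 2 * (K * s * x) * (t / 2) := by linear_combination (-K * x) * hst
          _ ≤ _ := mul_le_mul_of_nonneg_left h3 h4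
      have h5 : (V 0 * s / 2 - K * s ^ 2) ^ 2 ≤ K * s := by
        have : (V 0 * s / 2 - K * s ^ 2) ^ 2 ≤ (K * s) ^ 2 :=
          sq_le_sq' (by linarith) (by nlinarith)
        nlinarith
      have e : (t + V 0 * s / 2 - K * s ^ 2 + 2 * -(K * s / 2) * x) ^ 2 - 2 * -(K * s / 2)
          = t ^ 2 + V 0 - K * s + (V 0 * s / 2 - K * s ^ 2) ^ 2
            - 2 * (K * s * x) * (t + V 0 * s / 2 - K * s ^ 2 - K * s * x / 2) := by
        linear_combination (V 0 - 2 * K * s) * hst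
      linarith
  · have hE1 : Real.exp (-(t * L / 2)) < 1 := by
      rw [Real.exp_lt_one_iff]
      have := mul_pos ht0 hL
      linarith
    have hp : t / 2 ≤ t + V 0 * s / 2 + K * s ^ 2 := by
      have : 0 ≤ K * s ^ 2 := by positivity
      linarith
    have key := le_deriv_zero_of_subsolution (p := t + V 0 * s / 2 + K * s ^ 2)
      (r := K * s / 2) hL hq hf hf2 h0 hfL (fun x hx => ?_) (Real.exp_pos _).le hE1 ?_
    · have hE' : 0 < 1 - Real.exp (-(t * L / 2)) := sub_pos.2 hE1
      rw [div_le_iff₀ hE'] at key ⊢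
      rw [hKt]
      have := mul_le_mul_of_nonneg_left key ht0.le
      have e : t * -(t + V 0 * s / 2 + K * s ^ 2) = -t ^ 2 - V 0 / 2 - K * s := by
        linear_combination (-V 0 / 2 - K * s) * hst
      linarith
    · have h1 := (abs_le.1 (hVK x hx)).2
      have h2 : K * x ≤ 2 * (K * s * x) * (t + V 0 * s / 2 + K * s ^ 2) := by
        have h4 : 0 ≤ 2 * (K * s * x) := by have := hx.1; positivity
        calc K * x = 2 * (K * s * x) * (t / 2) := by linear_combination (-K * x) * hst
          _ ≤ _ := mul_le_mul_of_nonneg_left hp h4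
      have e : (t + V 0 * s / 2 + K * s ^ 2 + 2 * (K * s / 2) * x) ^ 2 - 2 * (K * s / 2)
          = t ^ 2 + V 0 + K * s + (V 0 * s / 2 + K * s ^ 2) ^ 2 + (K * s * x) ^ 2
            + 2 * (K * s * x) * (t + V 0 * s / 2 + K * s ^ 2) := by
        linear_combination (V 0 + 2 * K * s) * hst
      have := sq_nonneg (V 0 * s / 2 + K * s ^ 2)
      have := sq_nonneg (K * s * x)
      linarith
    · rw [Real.exp_le_exp]
      have := mul_le_mul_of_nonneg_right hp hL.le
      have : 0 ≤ K * s / 2 * L ^ 2 := by positivity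
      linarith

/-- A `C¹` function is bounded on `[0, L]` and Lipschitz at `0`, with a common constant. -/
theorem exists_bound_and_lipschitz {L : ℝ} (hL : 0 < L) {V : ℝ → ℝ} (hV : ContDiff ℝ 1 V) :
    ∃ K : ℝ, 1 ≤ K ∧ (∀ x ∈ Set.Icc 0 L, |V x| ≤ K) ∧
      ∀ x ∈ Set.Icc 0 L, |V x - V 0| ≤ K * x := by
  obtain ⟨hd, hc⟩ := contDiff_one_iff_deriv.1 hV
  obtain ⟨A, hA⟩ := isCompact_Icc.exists_bound_of_continuousOn (hd.continuous.continuousOn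
    (s := Set.Icc 0 L))
  obtain ⟨B, hB⟩ := isCompact_Icc.exists_bound_of_continuousOn (hc.continuousOn
    (s := Set.Icc 0 L))
  refine ⟨max 1 (max A B), le_max_left _ _,
    fun x hx => (hA x hx).trans ((le_max_left _ _).trans (le_max_right _ _)), fun x hx => ?_⟩
  have key := (convex_Icc 0 L).norm_image_sub_le_of_norm_deriv_le
    (fun y _ => hd y) hB ⟨le_rfl, hL.le⟩ hx
  rw [sub_zero, Real.norm_of_nonneg hx.1] at key
  exact key.trans (mul_le_mul_of_nonneg_right
    ((le_max_right _ _).trans (le_max_right _ _)) hx.1)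

/-- For a smooth potential `V` on `[0, L]` there is `T > 0` such that for every
`t ≥ T` the boundary value problem `f'' = (V + t²) f` on `[0, L]`, `f(0) = 1`,
`f(L) = 0`, has a unique C² solution `f_t` (unique on `[0, L]`), and
`t (f_t'(0) + t) → -V(0)/2` as `t → ∞`, i.e. `f_t'(0) ∼ -t - V(0)/(2t) + ⋯`. -/
theorem stmt_18 (L : ℝ) (hL : 0 < L) (V : ℝ → ℝ) (hV : ContDiff ℝ (⊤ : ℕ∞) V) :
    ∃ T : ℝ, 0 < T ∧ ∃ F : ℝ → ℝ → ℝ,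
      (∀ t : ℝ, T ≤ t →
        (ContDiff ℝ 2 (F t) ∧
          (∀ x ∈ Set.Icc 0 L, deriv (deriv (F t)) x = (V x + t ^ 2) * F t x) ∧
          F t 0 = 1 ∧ F t L = 0) ∧
        (∀ g : ℝ → ℝ, ContDiff ℝ 2 g →
          (∀ x ∈ Set.Icc 0 L, deriv (deriv g) x = (V x + t ^ 2) * g x) →
          g 0 = 1 → g L = 0 → Set.EqOn g (F t) (Set.Icc 0 L))) ∧
      Tendsto (fun t : ℝ => t * (deriv (F t) 0 + t)) atTop (nhds (-V 0 / 2)) := by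
  obtain ⟨K, hK, hVb, hVK⟩ := exists_bound_and_lipschitz hL (hV.of_le (by exact_mod_cast le_top))
  have hKL : 0 < K * L := by positivity
  have hlarge (t : ℝ) (ht : 4 * K * (1 + L) ≤ t) : 4 ≤ t ∧ 4 * K ≤ t :=
    ⟨by linarith, by linarith⟩
  have hex (t : ℝ) : ∃ f : ℝ → ℝ, 4 * K * (1 + L) ≤ t → ContDiff ℝ 2 f ∧
      (∀ x ∈ Set.Icc 0 L, deriv (deriv f) x = (V x + t ^ 2) * f x) ∧ f 0 = 1 ∧ f L = 0 := by
    by_cases ht : 4 * K * (1 + L) ≤ t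
    · obtain ⟨h1, h2⟩ := hlarge t ht
      obtain ⟨f, hf⟩ := exists_dirichlet_solution hL (by linarith : 0 < t) hV.continuous hVb
        (by nlinarith)
      exact ⟨f, fun _ => hf⟩
    · exact ⟨0, fun h => absurd h ht⟩
  choose F hF using hex
  refine ⟨4 * K * (1 + L), by positivity, F, fun t ht => ⟨hF t ht, fun g hg hg2 hg0 hgL => ?_⟩, ?_⟩
  · obtain ⟨hf, hf2, hf0, hfL⟩ := hF t ht
    refine eqOn_of_dirichlet (q := fun x => V x + t ^ 2) (fun x hx => ?_) hg hf hg2 hf2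
      (hg0.trans hf0.symm) (hgL.trans hfL.symm)
    have := (abs_le.1 (hVb x hx)).1
    obtain ⟨h1, h2⟩ := hlarge t ht
    nlinarith
  · have hKt : Tendsto (fun t : ℝ => K / t) atTop (𝓝 0) := tendsto_const_nhds.div_atTop tendsto_id
    have hmul : Tendsto (fun t : ℝ => t * L / 2) atTop atTop :=
      (tendsto_id.atTop_mul_const hL).atTop_div_const two_pos
    have hE : Tendsto (fun t : ℝ => Real.exp (-(t * L / 2))) atTop (𝓝 0) :=
      Real.tendsto_exp_neg_atTop_nhds_zero.comp hmul
    have hE2 : Tendsto (fun t : ℝ => t ^ 2 * Real.exp (-(t * L / 2))) atTop (𝓝 0) := by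
      have := ((Real.tendsto_pow_mul_exp_neg_atTop_nhds_zero 2).comp hmul).const_mul ((2 / L) ^ 2)
      rw [mul_zero] at this
      refine this.congr fun t => ?_
      simp only [Function.comp_apply]
      field_simp
    have hlow : Tendsto (fun t : ℝ =>
        (-V 0 / 2 - K / t - t ^ 2 * Real.exp (-(t * L / 2))) / (1 - Real.exp (-(t * L / 2))))
        atTop (𝓝 (-V 0 / 2)) := by
      have := ((hKt.const_sub (-V 0 / 2)).sub hE2).div (hE.const_sub 1) (by norm_num)
      simp only [sub_zero, div_one] at this
      exact this
    have hup : Tendsto (fun t : ℝ => -V 0 / 2 + K / t) atTop (𝓝 (-V 0 / 2)) := by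
      simpa using hKt.const_add (-V 0 / 2)
    have hbounds (t : ℝ) (ht : 4 * K * (1 + L) ≤ t) :=
      deriv_zero_bounds hL hK ht hVb hVK (hF t ht).1 (hF t ht).2.1 (hF t ht).2.2.1 (hF t ht).2.2.2
    refine tendsto_of_tendsto_of_tendsto_of_le_of_le' hlow hup ?_ ?_
    · filter_upwards [eventually_ge_atTop (4 * K * (1 + L))] with t ht using (hbounds t ht).2
    · filter_upwards [eventually_ge_atTop (4 * K * (1 + L))] with t ht using (hbounds t ht).1
end
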